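/- Let m ≥ 1 be an integer and let A be a smooth function on a dilation-invariant open set U ⊆ ℝ^N which is homogeneous of degree u ∈ ℝ. Then Δ(Q^m·A) = Q^m·ΔA + 2m(n + 2u + 2m)·Q^{m−1}·A on U. (This is the computation Δ̃(Q^m A) = 4m(w + n/2 − m)Q^{m−1}A + O(Q^m), the key step in the paper's harmonic-extension proposition, here with u the homogeneity of A itself.) -/

import Mathlib

noncomputable section

open scoped BigOperators

/-- The `i`-th partial derivative of a function on `ℝ^N`. -/
def pderiv' {N : ℕ} (i : Fin N) (f : (Fin N → ℝ) → ℝ) : (Fin N → ℝ) → ℝ :=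
  fun x => fderiv ℝ f x (Pi.single i 1)

/-- The flat pseudo-Laplacian `Δf = ∑ i, εᵢ ∂²f/∂xᵢ²` with signs `ε`. -/
def lapE {N : ℕ} (ε : Fin N → ℝ) (f : (Fin N → ℝ) → ℝ) : (Fin N → ℝ) → ℝ :=
  fun x => ∑ i, ε i * pderiv' i (pderiv' i f) x

/-- The Euler operator `(Ef)(x) = ∑ i, xᵢ ∂f/∂xᵢ (x)`. -/
def eulerOp {N : ℕ} (f : (Fin N → ℝ) → ℝ) : (Fin N → ℝ) → ℝ :=
  fun x => ∑ i, x i * pderiv' i f x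

/-- The quadratic form `Q(x) = ∑ i, εᵢ xᵢ²`. -/
def Qform {N : ℕ} (ε : Fin N → ℝ) : (Fin N → ℝ) → ℝ :=
  fun x => ∑ i, ε i * (x i) ^ 2

/-- An open set `U ⊆ ℝ^N` is dilation-invariant if `t • x ∈ U` for `x ∈ U`, `t > 0`. -/
def DilationInvariant {N : ℕ} (U : Set (Fin N → ℝ)) : Prop :=
  ∀ x ∈ U, ∀ t : ℝ, 0 < t → t • x ∈ U

/-- `f` is homogeneous of degree `w` on `U`: `f(t • x) = t^w f(x)` for `x ∈ U`, `t > 0`. -/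
def HomogeneousOn {N : ℕ} (f : (Fin N → ℝ) → ℝ) (w : ℝ) (U : Set (Fin N → ℝ)) : Prop :=
  ∀ x ∈ U, ∀ t : ℝ, 0 < t → f (t • x) = t ^ w * f x

lemma pd_mul {N : ℕ} (i : Fin N) (f g : (Fin N → ℝ) → ℝ) (x : Fin N → ℝ)
    (hf : DifferentiableAt ℝ f x) (hg : DifferentiableAt ℝ g x) :
    pderiv' i (fun y => f y * g y) x = pderiv' i f x * g x + f x * pderiv' i g x := by
  have h := (hf.hasFDerivAt.mul hg.hasFDerivAt).fderiv
  unfold pderiv'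
  change (fderiv ℝ (f * g) x) _ = _
  rw [h]
  simp
  ring

lemma pd_add {N : ℕ} (i : Fin N) (f g : (Fin N → ℝ) → ℝ) (x : Fin N → ℝ)
    (hf : DifferentiableAt ℝ f x) (hg : DifferentiableAt ℝ g x) :
    pderiv' i (fun y => f y + g y) x = pderiv' i f x + pderiv' i g x := by
  have h := (hf.hasFDerivAt.add hg.hasFDerivAt).fderiv
  unfold pderiv'
  change (fderiv ℝ (f + g) x) _ = _
  rw [h]
  simp

lemma diff_Q {N : ℕ} (ε : Fin N → ℝ) : Differentiable ℝ (Qform ε) := by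
  unfold Qform
  fun_prop

lemma pd_Q {N : ℕ} (ε : Fin N → ℝ) (i : Fin N) (x : Fin N → ℝ) :
    pderiv' i (Qform ε) x = 2 * ε i * x i := by
  have h : HasFDerivAt (Qform ε)
      (∑ j, (2 * ε j * x j) • (ContinuousLinearMap.proj j : (Fin N → ℝ) →L[ℝ] ℝ)) x := by
    unfold Qform
    refine HasFDerivAt.fun_sum fun j _ => ?_
    have h1 : HasFDerivAt (fun y : Fin N → ℝ => y j)
      (ContinuousLinearMap.proj j : (Fin N → ℝ) →L[ℝ] ℝ) x := hasFDerivAt_apply j x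
    have h2 := (h1.pow 2).const_mul (ε j)
    refine h2.congr_fderiv ?_
    ext v
    simp
    ring
  unfold pderiv'
  rw [h.fderiv]
  simp [Pi.single_apply]

lemma pd_lin {N : ℕ} (i : Fin N) (c : ℝ) (x : Fin N → ℝ) :
    pderiv' i (fun y => c * y i) x = c := by
  have h1 : HasFDerivAt (fun y : Fin N → ℝ => y i)
      (ContinuousLinearMap.proj i : (Fin N → ℝ) →L[ℝ] ℝ) x := hasFDerivAt_apply i x
  unfold pderiv'
  rw [(h1.const_mul c).fderiv]
  simp

lemma pd_Qpow {N : ℕ} (ε : Fin N → ℝ) (i : Fin N) (k : ℕ) (x : Fin N → ℝ) :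
    pderiv' i (fun y => Qform ε y ^ k) x = k * Qform ε x ^ (k - 1) * (2 * ε i * x i) := by
  have h := ((diff_Q ε x).hasFDerivAt.pow k).fderiv
  have hq := pd_Q ε i x
  unfold pderiv' at hq ⊢
  rw [← hq, h]
  simp
  try ring

lemma euler_eq {N : ℕ} (U : Set (Fin N → ℝ)) (A : (Fin N → ℝ) → ℝ) (u : ℝ)
    (hu : HomogeneousOn A u U) (x : Fin N → ℝ) (hx : x ∈ U) (hA : DifferentiableAt ℝ A x) :
    eulerOp A x = u * A x := by
  have h1 : HasDerivAt (fun t : ℝ => t • x) x 1 := by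
    simpa using (hasDerivAt_id (1 : ℝ)).smul_const x
  have h2 : HasDerivAt (fun t : ℝ => A (t • x)) (fderiv ℝ A x x) 1 := by
    have h3 : HasFDerivAt A (fderiv ℝ A x) ((1 : ℝ) • x) := by
      simpa using hA.hasFDerivAt
    exact h3.comp_hasDerivAt (1 : ℝ) h1
  have h4 : HasDerivAt (fun t : ℝ => t ^ u * A x) (u * A x) 1 := by
    have := (Real.hasDerivAt_rpow_const (x := 1) (p := u) (Or.inl one_ne_zero)).mul_const (A x)
    simpa using this
  have h5 : (fun t : ℝ => A (t • x)) =ᶠ[nhds 1] fun t : ℝ => t ^ u * A x := by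
    filter_upwards [lt_mem_nhds (zero_lt_one (α := ℝ))] with t ht
    exact hu x hx t ht
  have h6 := h2.unique (h4.congr_of_eventuallyEq h5)
  rw [← h6]
  unfold eulerOp pderiv'
  conv_rhs => rw [pi_eq_sum_univ' x]
  rw [map_sum]
  refine Finset.sum_congr rfl fun i _ => ?_
  rw [map_smul, smul_eq_mul]
  rw [← pi_eq_sum_univ' x]

/-- Flat-model identity `Δ(Q^m·A) = Q^m·ΔA + 2m(n + 2u + 2m)·Q^(m−1)·A` for `A`
homogeneous of degree `u`. -/
theorem lap_Qpow_mul (n : ℕ) (hn : 1 ≤ n) (ε : Fin (n + 2) → ℝ)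
    (hε : ∀ i, ε i = 1 ∨ ε i = -1)
    (U : Set (Fin (n + 2) → ℝ)) (hU : IsOpen U) (hUdil : DilationInvariant U)
    (A : (Fin (n + 2) → ℝ) → ℝ) (hA : ContDiffOn ℝ (⊤ : ℕ∞) A U)
    (u : ℝ) (hu : HomogeneousOn A u U)
    (m : ℕ) (hm : 1 ≤ m) :
    ∀ x ∈ U,
      lapE ε (fun y => (Qform ε y) ^ m * A y) x
        = (Qform ε x) ^ m * lapE ε A x
          + 2 * (m : ℝ) * ((n : ℝ) + 2 * u + 2 * (m : ℝ)) * (Qform ε x) ^ (m - 1) * A x := by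
  intro x hx
  obtain ⟨k, rfl⟩ : ∃ k, m = k + 1 := ⟨m - 1, by omega⟩
  have hAt : ∀ y ∈ U, ContDiffAt ℝ (⊤ : ℕ∞) A y := fun y hy => hA.contDiffAt (hU.mem_nhds hy)
  have hAd : ∀ y ∈ U, DifferentiableAt ℝ A y := fun y hy => (hAt y hy).differentiableAt (by simp)
  have hpd : ∀ i, DifferentiableAt ℝ (pderiv' i A) x := by
    intro i
    have h1 : DifferentiableAt ℝ (fderiv ℝ A) x :=
      ((hAt x hx).fderiv_right (m := 1) (by
        have : ((1 + 1 : ℕ∞) : WithTop ℕ∞) ≤ ((⊤ : ℕ∞) : WithTop ℕ∞) := WithTop.coe_le_coe.2 le_top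
        exact this)).differentiableAt (by simp)
    unfold pderiv'
    exact h1.clm_apply (differentiableAt_const _)
  have hQp : ∀ j, Differentiable ℝ (fun y => Qform ε y ^ j) := fun j => (diff_Q ε).pow j
  have heu := euler_eq U A u hu x hx (hAd x hx)
  have hl : ∀ i, Differentiable ℝ (fun y : Fin (n + 2) → ℝ => (2 * (k + 1) * ε i) * y i) := by
    intro i
    fun_prop
  have key : ∀ i, pderiv' i (pderiv' i (fun y => Qform ε y ^ (k + 1) * A y)) x
      = k * Qform ε x ^ (k - 1) * (2 * ε i * x i) * ((2 * (k + 1) * ε i) * x i) * A x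
        + Qform ε x ^ k * (2 * (k + 1) * ε i) * A x
        + 2 * (Qform ε x ^ k * ((2 * (k + 1) * ε i) * x i) * pderiv' i A x)
        + Qform ε x ^ (k + 1) * pderiv' i (pderiv' i A) x := by
    intro i
    have e : pderiv' i (fun y => Qform ε y ^ (k + 1) * A y) =ᶠ[nhds x]
        fun y => (Qform ε y ^ k * ((2 * (k + 1) * ε i) * y i)) * A y
          + Qform ε y ^ (k + 1) * pderiv' i A y := by
      filter_upwards [hU.mem_nhds hx] with y hy
      rw [pd_mul i _ _ y (hQp _ y) (hAd y hy), pd_Qpow]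
      push_cast
      try simp only [Nat.add_sub_cancel]
      ring
    have e2 := e.fderiv_eq (𝕜 := ℝ)
    have e3 : pderiv' i (pderiv' i (fun y => Qform ε y ^ (k + 1) * A y)) x =
        pderiv' i (fun y => (Qform ε y ^ k * ((2 * (k + 1) * ε i) * y i)) * A y
          + Qform ε y ^ (k + 1) * pderiv' i A y) x := by
      conv_lhs => unfold pderiv'
      conv_rhs => unfold pderiv'
      exact congrArg (fun L => L (Pi.single i 1)) e2
    have d1 : DifferentiableAt ℝ
        (fun y => Qform ε y ^ k * ((2 * (k + 1) * ε i) * y i)) x := (hQp k x).mul (hl i x)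
    rw [e3, pd_add i _ _ x (d1.fun_mul (hAd x hx)) ((hQp _ x).fun_mul (hpd i)),
      pd_mul i _ _ x d1 (hAd x hx), pd_mul i _ _ x (hQp k x) (hl i x),
      pd_mul i _ _ x (hQp _ x) (hpd i), pd_Qpow, pd_Qpow, pd_lin]
    push_cast
    try simp only [Nat.add_sub_cancel]
    ring
  have hk : (k : ℝ) * Qform ε x ^ (k - 1) * Qform ε x = k * Qform ε x ^ k := by
    cases k with
    | zero => simp
    | succ j => simp only [Nat.add_sub_cancel]; ring
  have sq : ∀ i, ε i * ε i = 1 := by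
    intro i
    rcases hε i with h | h <;> rw [h] <;> norm_num
  have term : ∀ i, ε i * pderiv' i (pderiv' i (fun y => Qform ε y ^ (k + 1) * A y)) x
      = (4 * (k + 1) * (k * Qform ε x ^ (k - 1)) * A x) * (ε i * x i ^ 2)
        + Qform ε x ^ k * (2 * (k + 1)) * A x
        + (4 * (k + 1) * Qform ε x ^ k) * (x i * pderiv' i A x)
        + Qform ε x ^ (k + 1) * (ε i * pderiv' i (pderiv' i A) x) := by
    intro i
    rw [key i]
    linear_combination ((4 * (k + 1) * (k * Qform ε x ^ (k - 1)) * A x) * (ε i * x i ^ 2)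
        + Qform ε x ^ k * (2 * (k + 1)) * A x
        + (4 * (k + 1) * Qform ε x ^ k) * (x i * pderiv' i A x)) * sq i
  have tot : lapE ε (fun y => Qform ε y ^ (k + 1) * A y) x
      = (4 * (k + 1) * (k * Qform ε x ^ (k - 1)) * A x) * Qform ε x
        + (n + 2) * (Qform ε x ^ k * (2 * (k + 1)) * A x)
        + (4 * (k + 1) * Qform ε x ^ k) * eulerOp A x
        + Qform ε x ^ (k + 1) * lapE ε A x := by
    have hQ : Qform ε x = ∑ i, ε i * x i ^ 2 := rfl
    have hL : lapE ε A x = ∑ i, ε i * pderiv' i (pderiv' i A) x := rfl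
    have hE : eulerOp A x = ∑ i, x i * pderiv' i A x := rfl
    have hT : lapE ε (fun y => Qform ε y ^ (k + 1) * A y) x
      = ∑ i, ε i * pderiv' i (pderiv' i (fun y => Qform ε y ^ (k + 1) * A y)) x := rfl
    rw [hT, Finset.sum_congr rfl fun i _ => term i, Finset.sum_add_distrib,
      Finset.sum_add_distrib, Finset.sum_add_distrib, Finset.sum_const,
      ← Finset.mul_sum, ← Finset.mul_sum, ← Finset.mul_sum, ← hQ, ← hL, ← hE]
    simp
  rw [tot, heu]
  push_cast
  try simp only [Nat.add_sub_cancel]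
  linear_combination (4 * ((k : ℝ) + 1) * A x) * hk
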